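/- For all i ∈ {1, …, r} and s ≥ 0, P^{p*}_{σ'}-almost surely, k_{sn₀+1} ∈ B^i_{j_s} if and only if k₁ ∈ K_i. Consequently, B_{j_s} = (B¹_{j_s}, …, B^r_{j_s}) is a partition of the support of the law of k_{sn₀+1} under P^{p*}_{σ'}, and P^{p*}_{σ'}(k_{sn₀+1} ∈ B^i_{j_s}) = p*(K_i). -/

import Mathlib

open MeasureTheory Filter

namespace PomdpPaper

/-- A belief (probability vector) on `Fin n`. -/
def IsBelief {n : ℕ} (p : Fin n → ℝ) : Prop :=
  (∀ k, 0 ≤ p k) ∧ ∑ k, p k = 1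

/-- The measure on a finite type associated with a probability vector. -/
noncomputable def vecMeasure {α : Type*} [Fintype α] [MeasurableSpace α] (p : α → ℝ) :
    Measure α :=
  ∑ x : α, ENNReal.ofReal (p x) • Measure.dirac x

/-- The Dirac belief at a point. -/
def diracBelief {n : ℕ} (k : Fin n) : Fin n → ℝ := fun k' => if k' = k then 1 else 0

/-- The `i`-th binary digit of a real number `x ∈ [0,1)` (as a real number `0` or `1`). -/
noncomputable def digitR (x : ℝ) (i : ℕ) : ℝ :=
  if ⌊x * 2 ^ (i + 1)⌋ % 2 = 1 then 1 else 0

/-- From one uniform seed `x ∈ [0,1)`, a sequence `unif x 0, unif x 1, …` of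
(independent, uniformly distributed on `[0,1]`) real numbers, obtained by splitting the
binary digits of `x` along the pairing function. -/
noncomputable def unif (x : ℝ) (m : ℕ) : ℝ :=
  ∑' j : ℕ, digitR x (Nat.pair m j) / 2 ^ (j + 1)

open Classical in
/-- Inverse-transform sampling from a probability vector on `Fin n` using a seed `u ∈ [0,1]`. -/
noncomputable def sampleFin {n : ℕ} (hn : 0 < n) (p : Fin n → ℝ) (u : ℝ) : Fin n :=
  let s : Finset (Fin n) :=
    Finset.univ.filter fun y : Fin n => u < ∑ z ∈ Finset.univ.filter fun z : Fin n => z ≤ y, p z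
  if hs : s.Nonempty then s.min' hs else ⟨0, hn⟩

/-- Inverse-transform sampling from a probability vector on a finite nonempty type. -/
noncomputable def sampleOn {β : Type*} [Fintype β] [Nonempty β] (p : β → ℝ) (u : ℝ) : β :=
  (Fintype.equivFin β).symm
    (sampleFin Fintype.card_pos (fun i => p ((Fintype.equivFin β).symm i)) u)

/-- A POMDP with states `Fin nK`, actions `Fin nA`, signals `Fin nS`, transition function `q`
and reward function `g` with values in `[0,1]`. -/
structure POMDP where
  nK : ℕ
  nA : ℕ
  nS : ℕ
  hK : 0 < nK
  hA : 0 < nA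
  hS : 0 < nS
  q : Fin nK → Fin nA → Fin nK × Fin nS → ℝ
  q_nonneg : ∀ k a y, 0 ≤ q k a y
  q_sum : ∀ k a, ∑ y, q k a y = 1
  g : Fin nK → Fin nA → ℝ
  g_nonneg : ∀ k a, 0 ≤ g k a
  g_le_one : ∀ k a, g k a ≤ 1

namespace POMDP

variable (Γ : POMDP)

/-- The state space. -/
abbrev K := Fin Γ.nK
/-- The action space. -/
abbrev A := Fin Γ.nA
/-- The signal space. -/
abbrev S := Fin Γ.nS

instance : Nonempty Γ.K := ⟨⟨0, Γ.hK⟩⟩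
instance : Nonempty Γ.A := ⟨⟨0, Γ.hA⟩⟩
instance : Nonempty Γ.S := ⟨⟨0, Γ.hS⟩⟩

/-- A history: the finite sequence of past actions and signals. -/
abbrev Hist := List (Γ.A × Γ.S)

/-- A (pure) strategy: a map from histories to actions. -/
abbrev Strategy := Γ.Hist → Γ.A

/-- The sample space carrying all the randomness: an initial state together with a
uniform seed in `[0,1)` used to draw all the transitions. -/
abbrev Env := Γ.K × ℝ

/-- The probability measure on the sample space induced by the initial belief `p1`:
the initial state is drawn according to `p1`, the seed uniformly on `[0,1)`. -/
noncomputable def envMeasure (p1 : Γ.K → ℝ) : Measure Γ.Env :=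
  (vecMeasure p1).prod (volume.restrict (Set.Ico (0 : ℝ) 1))

/-- The trajectory: `(Γ.traj σ ω m).1` is the state `k_{m+1}` at stage `m+1` and
`(Γ.traj σ ω m).2` is the history before stage `m+1` (of length `m`), when the
decision-maker uses strategy `σ` and the randomness is `ω`.  At each stage, the pair
(new state, signal) is drawn from `q` via inverse-transform sampling from a fresh
uniform variable. -/
noncomputable def traj (σ : Γ.Strategy) (ω : Γ.Env) : ℕ → Γ.K × Γ.Hist
  | 0 => (ω.1, [])
  | m + 1 =>
    let p := traj σ ω m
    let a := σ p.2
    let y := sampleOn (Γ.q p.1 a) (unif ω.2 m)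
    (y.1, p.2 ++ [(a, y.2)])

/-- The state `k_{m+1}` at stage `m+1` (`m` is 0-indexed). -/
noncomputable def state (σ : Γ.Strategy) (ω : Γ.Env) (m : ℕ) : Γ.K := (Γ.traj σ ω m).1

/-- The history before stage `m+1` (a list of length `m`). -/
noncomputable def hist (σ : Γ.Strategy) (ω : Γ.Env) (m : ℕ) : Γ.Hist := (Γ.traj σ ω m).2

/-- The action `a_{m+1}` played at stage `m+1`. -/
noncomputable def act (σ : Γ.Strategy) (ω : Γ.Env) (m : ℕ) : Γ.A := σ (Γ.hist σ ω m)

/-- The reward `g_{m+1}` obtained at stage `m+1`. -/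
noncomputable def rew (σ : Γ.Strategy) (ω : Γ.Env) (m : ℕ) : ℝ :=
  Γ.g (Γ.state σ ω m) (Γ.act σ ω m)

/-- The average reward over the first `n` stages. -/
noncomputable def avg (σ : Γ.Strategy) (ω : Γ.Env) (n : ℕ) : ℝ :=
  (1 / n : ℝ) * ∑ m ∈ Finset.range n, Γ.rew σ ω m

/-- The probability of an event under initial belief `p1` (the strategy `σ` is recorded for
readability; the underlying measure does not depend on it). -/
noncomputable def prob (p1 : Γ.K → ℝ) (_σ : Γ.Strategy) (E : Set Γ.Env) : ℝ :=
  (Γ.envMeasure p1 E).toReal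

/-- The long-run average payoff `γ^{p1}_∞(σ) = E[liminf (1/n) ∑ g_m]`. -/
noncomputable def pay (p1 : Γ.K → ℝ) (σ : Γ.Strategy) : ℝ :=
  ∫ ω, atTop.liminf (Γ.avg σ ω) ∂(Γ.envMeasure p1)

/-- The payoff starting from a deterministic state `k`, i.e. `γ^k_∞(σ)`. -/
noncomputable def payK (k : Γ.K) (σ : Γ.Strategy) : ℝ := Γ.pay (diracBelief k) σ

/-- The value `v_∞(p1)`. -/
noncomputable def val (p1 : Γ.K → ℝ) : ℝ := ⨆ σ : Γ.Strategy, Γ.pay p1 σ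

/-- A strategy has finite memory if it is implemented by a finite-state transducer. -/
def FiniteMemory (σ : Γ.Strategy) : Prop :=
  ∃ (n : ℕ) (m0 : Fin n) (σa : Fin n → Γ.A) (σu : Fin n → Γ.A × Γ.S → Fin n),
    ∀ h : Γ.Hist, σ h = σa (h.foldl σu m0)

/-- A blind MDP: the signal set is a singleton. -/
def Blind : Prop := Γ.nS = 1

/-- The strategy induced by a sequence of actions `a_1, a_2, …` (`as m` is the action played
at stage `m+1`, regardless of the observed history). -/
def blindStrat (as : ℕ → Γ.A) : Γ.Strategy := fun h => as h.length

end POMDP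

/-- A sequence is eventually periodic if it is periodic with some period `T ≥ 1` from
some stage `N` on. -/
def EventuallyPeriodic {α : Type*} (as : ℕ → α) : Prop :=
  ∃ T ≥ 1, ∃ N ≥ 1, ∀ m ≥ N, as (m + T) = as m


namespace POMDP

variable (Γ : POMDP)

/-- `Γ.stateProb k σ m k'` is the probability that the state at stage `m + 1` is `k'`,
starting from state `k` and playing `σ`. -/
noncomputable def stateProb (k : Γ.K) (σ : Γ.Strategy) (m : ℕ) (k' : Γ.K) : ℝ :=
  Γ.prob (diracBelief k) σ {ω | Γ.state σ ω m = k'}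

/-- The super-support at stage `m + 1` associated with the classes `Kc`:
`Γ.superSupp as Kc m i` is the set of states reached with positive probability at stage
`m + 1` under the blind strategy `as`, starting from a state in `Kc i`. -/
noncomputable def superSupp (as : ℕ → Γ.A) {r : ℕ} (Kc : Fin r → Finset Γ.K)
    (m : ℕ) (i : Fin r) : Set Γ.K :=
  {k' | ∃ k ∈ Kc i, 0 < Γ.stateProb k (Γ.blindStrat as) m k'}

end POMDP

/-- The `m`-shift of a sequence of actions. -/
def shiftSeq {α : Type*} (as : ℕ → α) (m : ℕ) : ℕ → α := fun t => as (m + t)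

open Classical in
/-- The representative stages used to define the eventually periodic strategy `σ'`:
`repStage Γ as Kc n0 0 = 0`, and `repStage Γ as Kc n0 (s+1)` is the least stage whose
super-support coincides with the super-support at stage `repStage Γ as Kc n0 s + n0`. -/
noncomputable def repStage (Γ : POMDP) (as : ℕ → Γ.A) {r : ℕ}
    (Kc : Fin r → Finset Γ.K) (n0 : ℕ) : ℕ → ℕ
  | 0 => 0
  | s + 1 =>
    have hex : ∃ m, Γ.superSupp as Kc m
        = Γ.superSupp as Kc (repStage Γ as Kc n0 s + n0) :=
      ⟨repStage Γ as Kc n0 s + n0, rfl⟩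
    Nat.find hex

/-- The strategy `σ'`: during the block of stages `s·n0 + 1, …, (s+1)·n0`, play the actions
that `σ` plays from stage `repStage … s` on. -/
noncomputable def blindSigma' (Γ : POMDP) (as : ℕ → Γ.A) {r : ℕ}
    (Kc : Fin r → Finset Γ.K) (n0 : ℕ) : ℕ → Γ.A :=
  fun m => as (repStage Γ as Kc n0 (m / n0) + m % n0)

/-! ### The seeds are i.i.d. uniform -/

/-- The uniform law on `[0,1)`. -/
noncomputable abbrev lam : Measure ℝ := volume.restrict (Set.Ico (0 : ℝ) 1)

instance lam_prob : IsProbabilityMeasure lam := ⟨by simp [lam]⟩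

/-- Boolean binary digits. -/
noncomputable def bitB (x : ℝ) (i : ℕ) : Bool := decide (⌊x * 2 ^ (i + 1)⌋ % 2 = 1)

/-- Value of a digit. -/
noncomputable def bval (b : Bool) : ℝ := if b then 1 else 0

lemma digitR_eq (x : ℝ) (i : ℕ) : digitR x i = bval (bitB x i) := by
  simp [digitR, bval, bitB]

lemma measurable_bitB (i : ℕ) : Measurable (fun x => bitB x i) := by
  have h : Measurable (fun x : ℝ => ⌊x * 2 ^ (i + 1)⌋) :=
    Int.measurable_floor.comp (by fun_prop)
  exact (measurable_from_top (f := fun z : ℤ => decide (z % 2 = 1))).comp h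

/-- Prefix value. -/
def pref (b : ℕ → Bool) : ℕ → ℤ
  | 0 => 0
  | n + 1 => 2 * pref b n + (if b n then 1 else 0)

lemma floor_double (x : ℝ) (n : ℕ) :
    ⌊x * 2 ^ (n + 1)⌋ = 2 * ⌊x * 2 ^ n⌋ + (if bitB x n then 1 else 0) := by
  have h1 : ⌊x * 2 ^ (n + 1)⌋ / 2 = ⌊x * 2 ^ n⌋ := by
    have : x * 2 ^ n = (x * 2 ^ (n + 1)) / ((2 : ℕ) : ℝ) := by
      rw [pow_succ]; push_cast; ring
    rw [this, Int.floor_div_natCast]; rfl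
  unfold bitB
  split_ifs with h <;> simp at h <;> omega

lemma pref_iff (b : ℕ → Bool) (n : ℕ) (x : ℝ) :
    (x ∈ Set.Ico (0 : ℝ) 1 ∧ ∀ i < n, bitB x i = b i) ↔ ⌊x * 2 ^ n⌋ = pref b n := by
  induction n with
  | zero => simp [pref, Int.floor_eq_iff]
  | succ n ih =>
    rw [floor_double, pref]
    have : (x ∈ Set.Ico (0 : ℝ) 1 ∧ ∀ i < n + 1, bitB x i = b i) ↔
        (x ∈ Set.Ico (0 : ℝ) 1 ∧ ∀ i < n, bitB x i = b i) ∧ bitB x n = b n := by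
      rw [and_assoc, Nat.forall_lt_succ_right]
    rw [this, ih]
    cases bitB x n <;> cases b n <;> simp <;> omega

lemma lam_cyl (b : ℕ → Bool) (n : ℕ) :
    lam {x | ∀ i < n, bitB x i = b i} = (2⁻¹ : ENNReal) ^ n := by
  have hm : MeasurableSet {x | ∀ i < n, bitB x i = b i} := by
    have : {x | ∀ i < n, bitB x i = b i} = ⋂ i, ⋂ (_ : i < n), (fun x => bitB x i) ⁻¹' {b i} := by
      ext; simp
    rw [this]
    exact MeasurableSet.iInter fun i => MeasurableSet.iInter fun _ =>
      measurable_bitB i (measurableSet_singleton _)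
  have he : {x | ∀ i < n, bitB x i = b i} ∩ Set.Ico (0 : ℝ) 1 =
      Set.Ico ((pref b n : ℝ) / 2 ^ n) (((pref b n : ℝ) + 1) / 2 ^ n) := by
    ext x
    have := pref_iff b n x
    rw [Int.floor_eq_iff] at this
    have h2 : (0 : ℝ) < 2 ^ n := by positivity
    simp only [Set.mem_inter_iff, Set.mem_ofPred_eq]
    rw [and_comm, this, Set.mem_Ico, div_le_iff₀ h2, lt_div_iff₀ h2]
  rw [Measure.restrict_apply hm, he, Real.volume_Ico]
  have : ((pref b n : ℝ) + 1) / 2 ^ n - (pref b n : ℝ) / 2 ^ n = (2 : ℝ)⁻¹ ^ n := by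
    rw [← sub_div]; simp
  rw [this, ENNReal.ofReal_pow (by norm_num), ENNReal.ofReal_inv_of_pos (by norm_num)]
  simp

/-- Fair coin. -/
noncomputable def coin : Measure Bool := (2⁻¹ : ENNReal) • Measure.count

lemma coin_singleton (b : Bool) : coin {b} = 2⁻¹ := by simp [coin]

instance coin_prob : IsProbabilityMeasure coin := ⟨by
  have : Measure.count (Set.univ : Set Bool) = 2 := by
    rw [Measure.count_univ]; simp
  rw [coin, Measure.smul_apply, this, smul_eq_mul]
  exact ENNReal.inv_mul_cancel two_ne_zero ENNReal.ofNat_ne_top⟩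

lemma measurable_bitB_all : Measurable bitB :=
  measurable_pi_iff.2 measurable_bitB

lemma map_bitB : lam.map bitB = Measure.infinitePi (fun _ : ℕ => coin) := by
  have key : ∀ n : ℕ, (lam.map bitB).map (Finset.range n).restrict =
      Measure.pi (fun _ : Finset.range n => coin) := by
    intro n
    refine Measure.ext_of_singleton fun b => ?_
    rw [Measure.pi_singleton, Measure.map_map (by fun_prop) measurable_bitB_all,
      Measure.map_apply ((Finset.measurable_restrict _).comp measurable_bitB_all)
        (measurableSet_singleton _)]
    simp only [coin_singleton, Finset.prod_const, Finset.card_univ, Fintype.card_coe,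
      Finset.card_range]
    rw [← lam_cyl (fun i => if h : i ∈ Finset.range n then b ⟨i, h⟩ else false) n]
    congr 1
    ext x
    simp only [Set.mem_preimage, Set.mem_singleton_iff, Set.mem_ofPred_eq, funext_iff,
      Function.comp, Finset.restrict, Subtype.forall, Finset.mem_range]
    refine forall_congr' fun i => forall_congr' fun hi => ?_
    simp [hi]
  refine Measure.eq_infinitePi _ fun s t ht => ?_
  obtain ⟨n, hn⟩ := s.exists_nat_subset_range
  rw [← Measure.infinitePi_pi (fun _ : ℕ => coin) (fun i _ => ht i)]
  have hset : Set.pi (s : Set ℕ) t = (Finset.range n).restrict ⁻¹'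
      {y : (Finset.range n) → Bool | ∀ i : Finset.range n, (i : ℕ) ∈ s → y i ∈ t i} := by
    ext y
    simp only [Set.mem_pi, Finset.mem_coe, Set.mem_preimage, Set.mem_ofPred_eq, Finset.restrict,
      Subtype.forall]
    exact ⟨fun h i _ hi => h i hi, fun h i hi => h i (hn hi) hi⟩
  have hmm : MeasurableSet
      {y : (Finset.range n) → Bool | ∀ i : Finset.range n, (i : ℕ) ∈ s → y i ∈ t i} :=
    Set.Finite.measurableSet (Set.toFinite _)
  rw [hset, ← Measure.map_apply (by fun_prop) hmm, ← Measure.map_apply (by fun_prop) hmm, key,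
    Measure.infinitePi_map_restrict]

/-- Real number with given binary digits. -/
noncomputable def ofBits (b : ℕ → Bool) : ℝ := ∑' j : ℕ, bval (b j) / 2 ^ (j + 1)

lemma measurable_ofBits : Measurable ofBits := by
  unfold ofBits
  refine Measurable.tsum fun j => ?_
  have : Measurable bval := measurable_from_top
  exact (this.comp (measurable_pi_apply j)).div_const _

lemma ofBits_bitB {x : ℝ} (hx : x ∈ Set.Ico (0 : ℝ) 1) : ofBits (bitB x) = x := by
  have hs : ∀ n, ∑ j ∈ Finset.range n, bval (bitB x j) / 2 ^ (j + 1) =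
      (⌊x * 2 ^ n⌋ : ℝ) / 2 ^ n := by
    intro n
    induction n with
    | zero =>
      have : ⌊x⌋ = 0 := Int.floor_eq_zero_iff.2 hx
      simp [this]
    | succ n ih =>
      rw [Finset.sum_range_succ, ih, floor_double, bval]
      have h2 : (2 : ℝ) ^ n ≠ 0 := by positivity
      rw [pow_succ]
      push_cast
      field_simp
  refine HasSum.tsum_eq ?_
  rw [hasSum_iff_tendsto_nat_of_nonneg]
  · simp_rw [hs]
    have h0 : Tendsto (fun n : ℕ => x - (1 / 2 : ℝ) ^ n) atTop (nhds (x - 0)) :=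
      tendsto_const_nhds.sub (tendsto_pow_atTop_nhds_zero_of_lt_one (by norm_num) (by norm_num))
    rw [sub_zero] at h0
    refine tendsto_of_tendsto_of_tendsto_of_le_of_le h0 tendsto_const_nhds ?_ ?_
    · intro n
      have h2 : (0 : ℝ) < 2 ^ n := by positivity
      have := Int.lt_floor_add_one (x * 2 ^ n)
      simp only [one_div, inv_pow]
      rw [le_div_iff₀ h2, sub_mul, inv_mul_cancel₀ h2.ne']
      linarith
    · intro n
      have h2 : (0 : ℝ) < 2 ^ n := by positivity
      simp only
      rw [div_le_iff₀ h2]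
      exact Int.floor_le _
  · intro i
    unfold bval
    split_ifs <;> positivity

lemma map_ofBits : (Measure.infinitePi (fun _ : ℕ => coin)).map ofBits = lam := by
  rw [← map_bitB, Measure.map_map measurable_ofBits measurable_bitB_all]
  have : (ofBits ∘ bitB) =ᵐ[lam] id := by
    filter_upwards [ae_restrict_mem measurableSet_Ico] with x hx
    exact ofBits_bitB hx
  rw [Measure.map_congr this, Measure.map_id]

lemma unif_eq (x : ℝ) (m : ℕ) : unif x m = ofBits (fun j => bitB x (Nat.pair m j)) := by
  simp [unif, ofBits, digitR_eq]

lemma measurable_unif (m : ℕ) : Measurable (fun x => unif x m) := by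
  simp_rw [unif_eq]
  exact measurable_ofBits.comp (measurable_pi_iff.2 fun j => measurable_bitB _)

lemma map_unif_all : lam.map unif = Measure.infinitePi (fun _ : ℕ => lam) := by
  have h1 : lam.map (fun x (p : ℕ × ℕ) => bitB x (Nat.pair p.1 p.2)) =
      Measure.infinitePi (fun _ : ℕ × ℕ => coin) := by
    have := Measure.map_infinitePi_infinitePi_of_inj (P := fun _ : ℕ => coin)
      (f := fun p : ℕ × ℕ => Nat.pair p.1 p.2) (by
        rintro ⟨a, b⟩ ⟨c, d⟩ h
        simpa [Nat.pair_eq_pair] using h)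
    rw [← this, ← map_bitB, Measure.map_map (by fun_prop) measurable_bitB_all]
    rfl
  have hmm : Measurable (fun x (p : ℕ × ℕ) => bitB x (Nat.pair p.1 p.2)) :=
    measurable_pi_iff.2 fun j => measurable_bitB _
  have h2 := Measure.infinitePi_map_curry (fun (_ : ℕ) (_ : ℕ) => coin)
  rw [← h1, Measure.map_map (by fun_prop) hmm] at h2
  have h3 := Measure.infinitePi_map_pi (fun _ : ℕ => Measure.infinitePi (fun _ : ℕ => coin))
    (f := fun _ : ℕ => ofBits) (fun _ => measurable_ofBits)
  simp only [map_ofBits] at h3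
  rw [← h3, ← h2, Measure.map_map]
  · congr 1
    ext x m
    simp only [unif_eq]
    rfl
  · exact measurable_pi_iff.2 fun j => measurable_ofBits.comp (measurable_pi_apply j)
  · exact (by fun_prop : Measurable (MeasurableEquiv.curry ℕ ℕ Bool)).comp hmm

lemma map_unif (m : ℕ) : lam.map (fun x => unif x m) = lam := by
  have h := Measure.infinitePi_map_eval (fun _ : ℕ => lam) m
  rw [← map_unif_all, Measure.map_map (measurable_pi_apply m)
    (measurable_pi_iff.2 measurable_unif)] at h
  exact h

lemma indep_unif : ProbabilityTheory.iIndepFun (fun m x => unif x m) lam := by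
  rw [ProbabilityTheory.iIndepFun_iff_map_fun_eq_infinitePi_map measurable_unif]
  simp only [map_unif]
  exact map_unif_all

/-! ### Sampling -/

open Classical in
lemma sampleFin_eq_iff {n : ℕ} (hn : 0 < n) (p : Fin n → ℝ) (hp : ∀ y, 0 ≤ p y)
    (hp1 : ∑ y, p y = 1) {u : ℝ} (hu : u ∈ Set.Ico (0 : ℝ) 1) (y : Fin n) :
    sampleFin hn p u = y ↔
      u ∈ Set.Ico (∑ z ∈ Finset.univ.filter fun z : Fin n => z < y, p z)
        (∑ z ∈ Finset.univ.filter fun z : Fin n => z ≤ y, p z) := by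
  set s : Finset (Fin n) :=
    Finset.univ.filter fun y : Fin n => u < ∑ z ∈ Finset.univ.filter fun z : Fin n => z ≤ y, p z
    with hs
  have hmem : ∀ y, y ∈ s ↔ u < ∑ z ∈ Finset.univ.filter fun z : Fin n => z ≤ y, p z := by
    intro y; simp [hs]
  have hne : s.Nonempty := by
    refine ⟨⟨n - 1, by omega⟩, (hmem _).2 ?_⟩
    have : (Finset.univ.filter fun z : Fin n => z ≤ ⟨n - 1, by omega⟩) = Finset.univ := by
      ext z
      simp only [Finset.mem_filter, Finset.mem_univ, true_and, iff_true, Fin.le_def]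
      omega
    rw [this, hp1]; exact hu.2
  have hdef : sampleFin hn p u = s.min' hne := by
    unfold sampleFin
    exact dif_pos hne
  rw [hdef]
  constructor
  · rintro rfl
    refine ⟨?_, (hmem _).1 (s.min'_mem hne)⟩
    set y := s.min' hne with hy
    rcases Nat.eq_zero_or_pos y.val with h0 | h0
    · have : (Finset.univ.filter fun z : Fin n => z < y) = ∅ := by
        ext z; simp only [Finset.mem_filter, Finset.mem_univ, true_and, Fin.lt_def, Finset.notMem_empty, iff_false]; omega
      rw [this]; simpa using hu.1
    · have hlt : (⟨y.val - 1, by omega⟩ : Fin n) ∉ s := by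
        intro h
        have := s.min'_le _ h
        rw [← hy, Fin.le_def] at this
        simp at this; omega
      rw [hmem, not_lt] at hlt
      refine le_trans (le_of_eq ?_) hlt
      refine Finset.sum_congr ?_ fun _ _ => rfl
      ext z; simp only [Finset.mem_filter, Finset.mem_univ, true_and, Fin.lt_def, Fin.le_def]; omega
  · rintro ⟨h1, h2⟩
    refine le_antisymm (s.min'_le _ ((hmem _).2 h2)) ?_
    by_contra hlt
    rw [not_le] at hlt
    have h3 := (hmem _).1 (s.min'_mem hne)
    refine absurd (lt_of_lt_of_le h3 ?_) (not_lt.2 h1)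
    refine Finset.sum_le_sum_of_subset_of_nonneg ?_ fun _ _ _ => hp _
    intro z
    simp only [Finset.mem_filter, Finset.mem_univ, true_and]
    exact fun h => lt_of_le_of_lt h hlt

open Classical in
lemma measurable_sampleFin {n : ℕ} (hn : 0 < n) (p : Fin n → ℝ) :
    Measurable (sampleFin hn p) := by
  let F : Fin n → ℝ := fun y => ∑ z ∈ Finset.univ.filter fun z : Fin n => z ≤ y, p z
  let Φ : (Fin n → Bool) → Fin n := fun c =>
    if h : (Finset.univ.filter fun y => c y = true).Nonempty then Finset.min' _ h else ⟨0, hn⟩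
  have h1 : Measurable (fun (u : ℝ) (y : Fin n) => decide (u < F y)) := by
    refine measurable_pi_iff.2 fun y => ?_
    refine measurable_to_bool ?_
    have : (fun u : ℝ => decide (u < F y)) ⁻¹' {true} = Set.Iio (F y) := by ext; simp
    rw [this]; exact measurableSet_Iio
  have h2 : Measurable Φ := measurable_of_finite _
  have : sampleFin hn p = Φ ∘ (fun (u : ℝ) (y : Fin n) => decide (u < F y)) := by
    ext u
    simp [sampleFin, Φ, F]
  rw [this]; exact h2.comp h1

lemma measurable_sampleOn {β : Type*} [Fintype β] [Nonempty β] [MeasurableSpace β] (p : β → ℝ) :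
    Measurable (sampleOn p) := by
  unfold sampleOn
  exact (measurable_of_finite _).comp (measurable_sampleFin _ _)

lemma lam_sampleFin {n : ℕ} (hn : 0 < n) (p : Fin n → ℝ) (hp : ∀ y, 0 ≤ p y)
    (hp1 : ∑ y, p y = 1) (y : Fin n) :
    lam {u | sampleFin hn p u = y} = ENNReal.ofReal (p y) := by
  classical
  have hm : MeasurableSet {u | sampleFin hn p u = y} :=
    measurable_sampleFin hn p (measurableSet_singleton y)
  have hsum : (∑ z ∈ Finset.univ.filter fun z : Fin n => z ≤ y, p z) =
      (∑ z ∈ Finset.univ.filter fun z : Fin n => z < y, p z) + p y := by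
    have : (Finset.univ.filter fun z : Fin n => z ≤ y) =
        insert y (Finset.univ.filter fun z : Fin n => z < y) := by
      ext z; simp [le_iff_lt_or_eq, or_comm]
    rw [this, Finset.sum_insert (by simp), add_comm]
  have hle : (∑ z ∈ Finset.univ.filter fun z : Fin n => z ≤ y, p z) ≤ 1 := by
    rw [← hp1]
    exact Finset.sum_le_sum_of_subset_of_nonneg (Finset.filter_subset _ _) fun _ _ _ => hp _
  have h0 : 0 ≤ (∑ z ∈ Finset.univ.filter fun z : Fin n => z < y, p z) :=
    Finset.sum_nonneg fun _ _ => hp _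
  rw [Measure.restrict_apply hm]
  have he : {u | sampleFin hn p u = y} ∩ Set.Ico (0 : ℝ) 1 =
      Set.Ico (∑ z ∈ Finset.univ.filter fun z : Fin n => z < y, p z)
        (∑ z ∈ Finset.univ.filter fun z : Fin n => z ≤ y, p z) := by
    ext u
    constructor
    · rintro ⟨h1, h2⟩
      have := (sampleFin_eq_iff hn p hp hp1 h2 y).1 h1
      convert this
    · intro h
      have h2 : u ∈ Set.Ico (0 : ℝ) 1 := ⟨h0.trans h.1, lt_of_lt_of_le h.2 hle⟩
      refine ⟨(sampleFin_eq_iff hn p hp hp1 h2 y).2 ?_, h2⟩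
      convert h
  rw [he, Real.volume_Ico, hsum, add_sub_cancel_left]

lemma lam_sampleOn {β : Type*} [Fintype β] [Nonempty β] (p : β → ℝ) (hp : ∀ y, 0 ≤ p y)
    (hp1 : ∑ y, p y = 1) (y : β) :
    lam {u | sampleOn p u = y} = ENNReal.ofReal (p y) := by
  have := lam_sampleFin Fintype.card_pos (fun i => p ((Fintype.equivFin β).symm i))
    (fun _ => hp _) (by rw [← hp1]; exact Equiv.sum_comp (Fintype.equivFin β).symm p)
    (Fintype.equivFin β y)
  simp only [Equiv.symm_apply_apply] at this
  rw [← this]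
  congr 1
  ext u
  simp [sampleOn, Equiv.symm_apply_eq]

/-! ### The state process -/

namespace POMDP

variable (Γ : POMDP)

/-- The state process frozen at `k` up to time `m`, driven by the seeds `u` afterwards. -/
noncomputable def runF (as : ℕ → Γ.A) (m : ℕ) (k : Γ.K) (u : ℕ → ℝ) : ℕ → Γ.K
  | 0 => k
  | t + 1 => if t < m then k else (sampleOn (Γ.q (runF as m k u t) (as t)) (u t)).1

lemma runF_le (as : ℕ → Γ.A) (m : ℕ) (k : Γ.K) (u : ℕ → ℝ) {t : ℕ} (h : t ≤ m) :
    Γ.runF as m k u t = k := by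
  cases t with
  | zero => rfl
  | succ t => rw [runF, if_pos (by omega)]

lemma runF_restart (as : ℕ → Γ.A) (m : ℕ) (k k' : Γ.K) (u : ℕ → ℝ)
    (hk : Γ.runF as 0 k u m = k') {t : ℕ} (h : m ≤ t) :
    Γ.runF as m k' u t = Γ.runF as 0 k u t := by
  induction t, h using Nat.le_induction with
  | base => rw [runF_le _ _ _ _ _ le_rfl, hk]
  | succ t ht ih => rw [runF, if_neg (by omega), ih]; simp [runF]

lemma traj_eq (as : ℕ → Γ.A) (k : Γ.K) (x : ℝ) (t : ℕ) :
    (Γ.traj (Γ.blindStrat as) (k, x) t).1 = Γ.runF as 0 k (unif x) t ∧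
      (Γ.traj (Γ.blindStrat as) (k, x) t).2.length = t := by
  induction t with
  | zero => simp [traj, runF]
  | succ t ih => simp [traj, runF, ih.1, ih.2, blindStrat]

lemma state_eq (as : ℕ → Γ.A) (k : Γ.K) (x : ℝ) (t : ℕ) :
    Γ.state (Γ.blindStrat as) (k, x) t = Γ.runF as 0 k (unif x) t := (Γ.traj_eq as k x t).1

lemma rew_eq (as : ℕ → Γ.A) (k : Γ.K) (x : ℝ) (t : ℕ) :
    Γ.rew (Γ.blindStrat as) (k, x) t = Γ.g (Γ.runF as 0 k (unif x) t) (as t) := by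
  rw [rew, state_eq, act, hist, blindStrat, (Γ.traj_eq as k x t).2]

lemma measurable_runF {X : Type*} [MeasurableSpace X] (as : ℕ → Γ.A) (m : ℕ) (k : Γ.K)
    (U : X → ℕ → ℝ) (t : ℕ) (hU : ∀ s, m ≤ s → s < t → Measurable (fun x => U x s)) :
    Measurable (fun x => Γ.runF as m k (U x) t) := by
  induction t with
  | zero => exact measurable_const
  | succ t ih =>
    by_cases h : t < m
    · simp only [runF, if_pos h]; exact measurable_const
    · simp only [runF, if_neg h]
      have h1 := ih fun s hs hst => hU s hs (by omega)
      have h2 := hU t (by omega) (by omega)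
      refine measurable_to_countable' fun k' => ?_
      have : (fun x => (sampleOn (Γ.q (Γ.runF as m k (U x) t) (as t)) (U x t)).1) ⁻¹' {k'} =
          ⋃ j : Γ.K, ((fun x => Γ.runF as m k (U x) t) ⁻¹' {j}) ∩
            ((fun x => U x t) ⁻¹' ((fun u => (sampleOn (Γ.q j (as t)) u).1) ⁻¹' {k'})) := by
        ext x; simp
      rw [this]
      refine MeasurableSet.iUnion fun j => (h1 (measurableSet_singleton j)).inter (h2 ?_)
      exact (measurable_fst.comp (measurable_sampleOn _)) (measurableSet_singleton k')

/-- Past and future σ-algebras. -/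
noncomputable abbrev sigAlg (S : Set ℕ) : MeasurableSpace ℝ :=
  ⨆ t ∈ S, MeasurableSpace.comap (fun x => unif x t) inferInstance

lemma measurable_sigAlg {S : Set ℕ} {t : ℕ} (ht : t ∈ S) :
    Measurable[sigAlg S] (fun x => unif x t) := by
  have h : MeasurableSpace.comap (fun x => unif x t) inferInstance ≤ sigAlg S :=
    le_iSup₂_of_le t ht le_rfl
  exact Measurable.mono (comap_measurable _) h le_rfl

lemma indep_sets {m : ℕ} {E F : Set ℝ} (hE : MeasurableSet[sigAlg {t | t < m}] E)
    (hF : MeasurableSet[sigAlg {t | m ≤ t}] F) : lam (E ∩ F) = lam E * lam F := by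
  have h := ProbabilityTheory.indep_iSup_of_disjoint
    (m := fun t => MeasurableSpace.comap (fun x => unif x t) inferInstance)
    (fun t => (measurable_unif t).comap_le)
    ((ProbabilityTheory.iIndepFun_iff_iIndep _ _ _).1 indep_unif)
    (S := {t | t < m}) (T := {t | m ≤ t})
    (Set.disjoint_left.2 fun t h1 h2 => by
      simp only [Set.mem_ofPred_eq] at h1 h2; omega)
  exact (ProbabilityTheory.Indep_iff _ _ _).1 h E F hE hF

/-- The law of the state at time `t` charges `k'`. -/
def Reach (as : ℕ → Γ.A) (k : Γ.K) (t : ℕ) (k' : Γ.K) : Prop :=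
  lam {x | Γ.runF as 0 k (unif x) t = k'} ≠ 0

lemma past_meas (as : ℕ → Γ.A) (k : Γ.K) (t : ℕ) (k' : Γ.K) :
    MeasurableSet[sigAlg {s | s < t}] {x | Γ.runF as 0 k (unif x) t = k'} := by
  have := @measurable_runF Γ ℝ (sigAlg {s | s < t}) as 0 k unif t
    (fun s _ hs => measurable_sigAlg hs)
  exact this (measurableSet_singleton k')

lemma measurable_run (as : ℕ → Γ.A) (k : Γ.K) (t : ℕ) :
    Measurable (fun x => Γ.runF as 0 k (unif x) t) :=
  Γ.measurable_runF as 0 k unif t (fun s _ _ => measurable_unif s)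

lemma reach_zero (as : ℕ → Γ.A) (k k' : Γ.K) : Γ.Reach as k 0 k' ↔ k' = k := by
  unfold Reach
  by_cases h : k = k'
  · simp [runF, h]
  · simp [runF, h, Ne.symm h]

lemma reach_succ (as : ℕ → Γ.A) (k : Γ.K) (t : ℕ) (k'' : Γ.K) :
    Γ.Reach as k (t + 1) k'' ↔ ∃ k', Γ.Reach as k t k' ∧ ∃ s, 0 < Γ.q k' (as t) (k'', s) := by
  unfold Reach
  have hset : {x | Γ.runF as 0 k (unif x) (t + 1) = k''} =
      ⋃ k' : Γ.K, {x | Γ.runF as 0 k (unif x) t = k'} ∩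
        {x | (sampleOn (Γ.q k' (as t)) (unif x t)).1 = k''} := by
    ext x; simp [runF]
  rw [hset, Ne, measure_iUnion_null_iff, not_forall]
  refine exists_congr fun k' => ?_
  rw [indep_sets (Γ.past_meas as k t k'), mul_eq_zero, not_or]
  · refine and_congr_right fun _ => ?_
    have h1 : {x | (sampleOn (Γ.q k' (as t)) (unif x t)).1 = k''} =
        (fun x => unif x t) ⁻¹' {u | (sampleOn (Γ.q k' (as t)) u).1 = k''} := rfl
    have h2 : MeasurableSet {u | (sampleOn (Γ.q k' (as t)) u).1 = k''} :=
      (measurable_fst.comp (measurable_sampleOn _)) (measurableSet_singleton k'')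
    have h3 : {u | (sampleOn (Γ.q k' (as t)) u).1 = k''} =
        ⋃ s : Γ.S, {u | sampleOn (Γ.q k' (as t)) u = (k'', s)} := by
      ext u; simp [Prod.ext_iff]
    rw [h1, ← Measure.map_apply (measurable_unif t) h2, map_unif, h3, measure_iUnion_null_iff,
      not_forall]
    refine exists_congr fun s => ?_
    rw [lam_sampleOn _ (Γ.q_nonneg k' (as t)) (Γ.q_sum k' (as t))]
    simp
  · have h1 : Measurable[sigAlg {s | t ≤ s}] (fun x => unif x t) := measurable_sigAlg (by simp)
    exact h1 ((measurable_fst.comp (measurable_sampleOn (Γ.q k' (as t))))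
      (measurableSet_singleton k''))

/-! ### Disjointness -/

/-- Average reward along the frozen process. -/
noncomputable def avgF (as : ℕ → Γ.A) (m : ℕ) (k : Γ.K) (u : ℕ → ℝ) (n : ℕ) : ℝ :=
  (n⁻¹ : ℝ) * ∑ t ∈ Finset.range n, Γ.g (Γ.runF as m k u t) (as t)

lemma avg_eq (as : ℕ → Γ.A) (k : Γ.K) (x : ℝ) (n : ℕ) :
    Γ.avg (Γ.blindStrat as) (k, x) n = Γ.avgF as 0 k (unif x) n := by
  simp [avg, avgF, rew_eq]

lemma avgF_tendsto (as : ℕ → Γ.A) (m : ℕ) (k k' : Γ.K) (u : ℕ → ℝ) (c : ℝ)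
    (hk : Γ.runF as 0 k u m = k') (h : Tendsto (Γ.avgF as 0 k u) atTop (nhds c)) :
    Tendsto (Γ.avgF as m k' u) atTop (nhds c) := by
  have h0 : Tendsto (fun t => Γ.g (Γ.runF as m k' u t) (as t) -
      Γ.g (Γ.runF as 0 k u t) (as t)) atTop (nhds 0) := by
    refine tendsto_const_nhds.congr' ?_
    filter_upwards [eventually_ge_atTop m] with t ht
    rw [Γ.runF_restart as m k k' u hk ht, sub_self]
  have h1 := h0.cesaro.add h
  rw [zero_add] at h1
  refine h1.congr fun n => ?_
  simp only [avgF]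
  rw [← mul_add, ← Finset.sum_add_distrib]
  simp

lemma future_ae (as : ℕ → Γ.A) (m : ℕ) (k k' : Γ.K) (c : ℝ)
    (hk : Γ.Reach as k m k')
    (h : ∀ᵐ x ∂lam, Tendsto (Γ.avgF as 0 k (unif x)) atTop (nhds c)) :
    ∀ᵐ x ∂lam, Tendsto (Γ.avgF as m k' (unif x)) atTop (nhds c) := by
  have hm : MeasurableSet[sigAlg {t | m ≤ t}]
      {x | Tendsto (Γ.avgF as m k' (unif x)) atTop (nhds c)} := by
    refine measurableSet_tendsto
      (f := fun n x => Γ.avgF as m k' (unif x) n) _ (fun n => ?_)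
    refine Measurable.const_mul ?_ _
    refine Finset.measurable_sum _ fun t _ => ?_
    have := @measurable_runF Γ ℝ (sigAlg {s | m ≤ s}) as m k' unif t
      (fun s hs _ => measurable_sigAlg hs)
    exact (measurable_from_top (f := fun j : Γ.K => Γ.g j (as t))).comp this
  have h0 := indep_sets (Γ.past_meas as k m k') hm.compl
  have h1 : lam ({x | Γ.runF as 0 k (unif x) m = k'} ∩
      {x | Tendsto (Γ.avgF as m k' (unif x)) atTop (nhds c)}ᶜ) = 0 := by
    refine measure_mono_null ?_ (ae_iff.1 h)
    rintro x ⟨hx1, hx2⟩ hx3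
    exact hx2 (Γ.avgF_tendsto as m k k' _ c hx1 hx3)
  rw [h1] at h0
  exact (mul_eq_zero.1 h0.symm).resolve_left hk

lemma reach_disj (as : ℕ → Γ.A) (m : ℕ) (k₁ k₂ k' : Γ.K) (c₁ c₂ : ℝ)
    (hk₁ : Γ.Reach as k₁ m k') (hk₂ : Γ.Reach as k₂ m k')
    (h₁ : ∀ᵐ x ∂lam, Tendsto (Γ.avgF as 0 k₁ (unif x)) atTop (nhds c₁))
    (h₂ : ∀ᵐ x ∂lam, Tendsto (Γ.avgF as 0 k₂ (unif x)) atTop (nhds c₂)) : c₁ = c₂ := by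
  obtain ⟨x, hx₁, hx₂⟩ :=
    ((Γ.future_ae as m k₁ k' c₁ hk₁ h₁).and (Γ.future_ae as m k₂ k' c₂ hk₂ h₂)).exists
  exact tendsto_nhds_unique hx₁ hx₂

/-! ### The environment measure -/

lemma envMeasure_apply (p : Γ.K → ℝ) {E : Set Γ.Env} (hE : MeasurableSet E) :
    Γ.envMeasure p E = ∑ k, ENNReal.ofReal (p k) * lam {x | (k, x) ∈ E} := by
  rw [envMeasure, Measure.prod_apply hE, vecMeasure, lintegral_finsetSum_measure]
  refine Finset.sum_congr rfl fun k _ => ?_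
  rw [lintegral_smul_measure, lintegral_dirac]
  rfl

lemma envMeasure_dirac (k : Γ.K) :
    Γ.envMeasure (diracBelief k) = lam.map (Prod.mk k) := by
  rw [envMeasure, ← Measure.dirac_prod]
  congr 1
  rw [vecMeasure, Finset.sum_eq_single k]
  · simp [diracBelief]
  · intro b _ hb; simp [diracBelief, hb]
  · simp

lemma measurable_env {α : Type*} [MeasurableSpace α] (f : Γ.Env → α)
    (h : ∀ k, Measurable (fun x => f (k, x))) : Measurable f :=
  measurable_from_prod_countable_right h

lemma measurable_state (as : ℕ → Γ.A) (t : ℕ) :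
    Measurable (fun ω => Γ.state (Γ.blindStrat as) ω t) := by
  refine Γ.measurable_env _ fun k => ?_
  simp only [state_eq]
  exact Γ.measurable_run as k t

lemma superSupp_iff (as : ℕ → Γ.A) {r : ℕ} (Kc : Fin r → Finset Γ.K) (m : ℕ) (i : Fin r)
    (k' : Γ.K) : k' ∈ Γ.superSupp as Kc m i ↔ ∃ k ∈ Kc i, Γ.Reach as k m k' := by
  unfold superSupp
  simp only [Set.mem_ofPred_eq]
  refine exists_congr fun k => and_congr_right fun _ => ?_
  have hms : MeasurableSet {ω | Γ.state (Γ.blindStrat as) ω m = k'} :=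
    Γ.measurable_state as m (measurableSet_singleton k')
  rw [stateProb, prob, envMeasure_dirac, Measure.map_apply measurable_prodMk_left hms,
    ENNReal.toReal_pos_iff]
  simp only [measure_lt_top, and_true, pos_iff_ne_zero, Reach]
  simp only [Set.preimage_setOf_eq, state_eq]

lemma super_step (as as' : ℕ → Γ.A) {r : ℕ} (Kc : Fin r → Finset Γ.K) (m m' : ℕ)
    (n : ℕ) (ha : ∀ t < n, as (m + t) = as' (m' + t))
    (h : Γ.superSupp as Kc m = Γ.superSupp as' Kc m') :
    ∀ t ≤ n, Γ.superSupp as Kc (m + t) = Γ.superSupp as' Kc (m' + t) := by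
  have key : ∀ (as : ℕ → Γ.A) (m : ℕ) (i : Fin r) (k' : Γ.K),
      k' ∈ Γ.superSupp as Kc (m + 1) i ↔
        ∃ j ∈ Γ.superSupp as Kc m i, ∃ s, 0 < Γ.q j (as m) (k', s) := by
    intro as m i k'
    simp only [superSupp_iff, reach_succ]
    constructor
    · rintro ⟨k, hk, j, hj, hs⟩; exact ⟨j, ⟨k, hk, hj⟩, hs⟩
    · rintro ⟨j, ⟨k, hk, hj⟩, hs⟩; exact ⟨k, hk, j, hj, hs⟩
  intro t
  induction t with
  | zero => intro _; exact h
  | succ t ih =>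
    intro ht
    ext i k'
    rw [← add_assoc, ← add_assoc, key, key, ih (by omega), ha t (by omega)]

end POMDP

lemma super_sigma (Γ : POMDP) (as : ℕ → Γ.A) {r : ℕ}
    (Kc : Fin r → Finset Γ.K) (n0 : ℕ) (hn0 : 1 ≤ n0) (s : ℕ) :
    Γ.superSupp (blindSigma' Γ as Kc n0) Kc (s * n0) =
      Γ.superSupp as Kc (repStage Γ as Kc n0 s) := by
  induction s with
  | zero =>
    ext i k'
    simp [repStage, POMDP.superSupp_iff, POMDP.reach_zero]
  | succ s ih =>
    have h1 : Γ.superSupp as Kc (repStage Γ as Kc n0 (s + 1)) =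
        Γ.superSupp as Kc (repStage Γ as Kc n0 s + n0) := by
      classical
      rw [repStage]
      exact Nat.find_spec (p := fun m => Γ.superSupp as Kc m
        = Γ.superSupp as Kc (repStage Γ as Kc n0 s + n0)) _
    rw [h1, Nat.succ_mul]
    refine Γ.super_step _ _ Kc _ _ n0 ?_ ih n0 le_rfl
    intro t ht
    have hd : (s * n0 + t) / n0 = s := by
      rw [mul_comm, Nat.mul_add_div (by omega), Nat.div_eq_of_lt ht, add_zero]
    have hm : (s * n0 + t) % n0 = t := by
      rw [mul_comm, Nat.mul_add_mod, Nat.mod_eq_of_lt ht]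
    rw [blindSigma', hd, hm]

/-- **Lemma 4.** Under the strategy `σ'`, almost surely the state at stage `s·n0 + 1` lies
in `B^i_{j_s}` if and only if the initial state lies in `K_i`.  Consequently `B_{j_s}` is a
partition of the support of the law of the state at stage `s·n0 + 1`, and
`P^{p*}_{σ'}(k_{s·n0+1} ∈ B^i_{j_s}) = p*(K_i)`. -/
theorem blind_superSupp_invariant (Γ : POMDP) (hΓ : Γ.Blind)
    (pstar : Γ.K → ℝ) (hps : IsBelief pstar) (as : ℕ → Γ.A)
    (herg : ∀ k, 0 < pstar k →
      ∀ᵐ ω ∂(Γ.envMeasure (diracBelief k)),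
        Tendsto (Γ.avg (Γ.blindStrat as) ω) atTop (nhds (Γ.payK k (Γ.blindStrat as))))
    (r : ℕ) (Kc : Fin r → Finset Γ.K) (γv : Fin r → ℝ)
    (hKc : ∀ k, 0 < pstar k ↔ ∃ i, k ∈ Kc i)
    (hcl : ∀ i, ∀ k ∈ Kc i, Γ.payK k (Γ.blindStrat as) = γv i)
    (hdist : ∀ i j, i ≠ j → γv i ≠ γv j)
    (hne : ∀ i, (Kc i).Nonempty)
    (n0 : ℕ) (hn0 : 1 ≤ n0) (i : Fin r) (s : ℕ) :
    (Γ.prob pstar (Γ.blindStrat (blindSigma' Γ as Kc n0))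
        {ω | Γ.state (Γ.blindStrat (blindSigma' Γ as Kc n0)) ω (s * n0)
              ∈ Γ.superSupp as Kc (repStage Γ as Kc n0 s) i
            ↔ Γ.state (Γ.blindStrat (blindSigma' Γ as Kc n0)) ω 0 ∈ Kc i} = 1) ∧
    (∀ j, i ≠ j → Disjoint (Γ.superSupp as Kc (repStage Γ as Kc n0 s) i)
        (Γ.superSupp as Kc (repStage Γ as Kc n0 s) j)) ∧
    ({k' | 0 < Γ.prob pstar (Γ.blindStrat (blindSigma' Γ as Kc n0))
        {ω | Γ.state (Γ.blindStrat (blindSigma' Γ as Kc n0)) ω (s * n0) = k'}}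
      = ⋃ j, Γ.superSupp as Kc (repStage Γ as Kc n0 s) j) ∧
    (Γ.prob pstar (Γ.blindStrat (blindSigma' Γ as Kc n0))
        {ω | Γ.state (Γ.blindStrat (blindSigma' Γ as Kc n0)) ω (s * n0)
              ∈ Γ.superSupp as Kc (repStage Γ as Kc n0 s) i}
      = ∑ k ∈ Kc i, pstar k) := by
  set τ := blindSigma' Γ as Kc n0 with hτ
  set B : Fin r → Set Γ.K := fun j => Γ.superSupp as Kc (repStage Γ as Kc n0 s) j with hB
  have hsup : ∀ j k', k' ∈ B j ↔ ∃ k ∈ Kc j, Γ.Reach τ k (s * n0) k' := by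
    intro j k'
    rw [← POMDP.superSupp_iff, hτ, super_sigma Γ as Kc n0 hn0 s]
  have herg' : ∀ j, ∀ k ∈ Kc j,
      ∀ᵐ x ∂lam, Tendsto (Γ.avgF as 0 k (unif x)) atTop (nhds (γv j)) := by
    intro j k hk
    have h := herg k ((hKc k).2 ⟨j, hk⟩)
    rw [POMDP.envMeasure_dirac] at h
    have h' := ae_of_ae_map measurable_prodMk_left.aemeasurable h
    filter_upwards [h'] with x hx
    rw [hcl j k hk] at hx
    exact hx.congr fun n => Γ.avg_eq as k x n
  have hdisj : ∀ j j', j ≠ j' → Disjoint (B j) (B j') := by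
    intro j j' hjj
    refine Set.disjoint_left.2 fun k' h1 h2 => ?_
    obtain ⟨k₁, hk₁, hr₁⟩ := (Γ.superSupp_iff as Kc _ j k').1 h1
    obtain ⟨k₂, hk₂, hr₂⟩ := (Γ.superSupp_iff as Kc _ j' k').1 h2
    exact hdist j j' hjj (Γ.reach_disj as _ k₁ k₂ k' _ _ hr₁ hr₂ (herg' j k₁ hk₁)
      (herg' j' k₂ hk₂))
  have hKdisj : ∀ j j' k, k ∈ Kc j → k ∈ Kc j' → j = j' := by
    intro j j' k h1 h2
    by_contra hne'
    exact hdist j j' hne' ((hcl j k h1).symm.trans (hcl j' k h2))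
  have hin : ∀ j, ∀ k ∈ Kc j, ∀ᵐ x ∂lam, Γ.runF τ 0 k (unif x) (s * n0) ∈ B j := by
    intro j k hk
    have h : ∀ᵐ x ∂lam, ∀ k', k' ∉ B j → Γ.runF τ 0 k (unif x) (s * n0) ≠ k' := by
      rw [ae_all_iff]
      intro k'
      by_cases hk' : k' ∈ B j
      · exact ae_of_all _ fun x h => absurd hk' h
      · have : ¬ Γ.Reach τ k (s * n0) k' := fun h => hk' ((hsup j k').2 ⟨k, hk, h⟩)
        rw [POMDP.Reach, not_not] at this
        have h2 : ∀ᵐ x ∂lam, Γ.runF τ 0 k (unif x) (s * n0) ≠ k' := by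
          rw [ae_iff]; simpa using this
        filter_upwards [h2] with x hx _ using hx
    filter_upwards [h] with x hx
    by_contra hcon
    exact hx _ hcon rfl
  have hiff : ∀ k, 0 < pstar k →
      ∀ᵐ x ∂lam, (Γ.runF τ 0 k (unif x) (s * n0) ∈ B i ↔ k ∈ Kc i) := by
    intro k hk
    obtain ⟨j, hj⟩ := (hKc k).1 hk
    filter_upwards [hin j k hj] with x hx
    by_cases hij : i = j
    · subst hij; exact iff_of_true hx hj
    · refine iff_of_false (fun h => Set.disjoint_left.1 (hdisj i j hij) h hx) fun h => ?_
      exact hij (hKdisj i j k h hj)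
  have hmS : ∀ (t : ℕ) (C : Set Γ.K),
      MeasurableSet {ω : Γ.Env | Γ.state (Γ.blindStrat τ) ω t ∈ C} := fun t C =>
    Γ.measurable_state τ t (Set.Finite.measurableSet (Set.toFinite C))
  have hmS' : ∀ (t : ℕ) (k' : Γ.K),
      MeasurableSet {ω : Γ.Env | Γ.state (Γ.blindStrat τ) ω t = k'} := fun t k' => hmS t {k'}
  refine ⟨?_, fun j hj => hdisj i j hj, ?_, ?_⟩
  · have hm : MeasurableSet {ω : Γ.Env | Γ.state (Γ.blindStrat τ) ω (s * n0) ∈ B i ↔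
        Γ.state (Γ.blindStrat τ) ω 0 ∈ Kc i} := by
      have h1 := hmS (s * n0) (B i)
      have h2 := hmS 0 (Kc i : Set Γ.K)
      exact h1.iff h2
    rw [POMDP.prob, POMDP.envMeasure_apply _ _ hm]
    have : ∀ k, ENNReal.ofReal (pstar k) * lam {x | (k, x) ∈ {ω : Γ.Env |
        Γ.state (Γ.blindStrat τ) ω (s * n0) ∈ B i ↔ Γ.state (Γ.blindStrat τ) ω 0 ∈ Kc i}} =
        ENNReal.ofReal (pstar k) := by
      intro k
      rcases (hps.1 k).eq_or_lt with h0 | h0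
      · simp [← h0]
      · have h1 : lam {x | (k, x) ∈ {ω : Γ.Env | Γ.state (Γ.blindStrat τ) ω (s * n0) ∈ B i ↔
            Γ.state (Γ.blindStrat τ) ω 0 ∈ Kc i}} = lam Set.univ := by
          refine measure_congr ?_
          filter_upwards [hiff k h0] with x hx
          refine propext (iff_of_true ?_ trivial)
          show Γ.state (Γ.blindStrat τ) (k, x) (s * n0) ∈ B i ↔
            Γ.state (Γ.blindStrat τ) (k, x) 0 ∈ Kc i
          rw [POMDP.state_eq, POMDP.state_eq]
          exact hx
        rw [h1, measure_univ, mul_one]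
    rw [Finset.sum_congr rfl fun k _ => this k, ← ENNReal.ofReal_sum_of_nonneg fun k _ => hps.1 k,
      hps.2]
    simp
  · ext k'
    simp only [Set.mem_ofPred_eq, Set.mem_iUnion]
    rw [POMDP.prob, POMDP.envMeasure_apply _ _ (hmS' _ _), ENNReal.toReal_pos_iff]
    have hfin : ∑ k, ENNReal.ofReal (pstar k) * lam {x | (k, x) ∈ {ω : Γ.Env |
        Γ.state (Γ.blindStrat τ) ω (s * n0) = k'}} < ⊤ :=
      ENNReal.sum_lt_top.2 fun k _ => ENNReal.mul_lt_top ENNReal.ofReal_lt_top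
        (measure_lt_top _ _)
    rw [and_iff_left hfin, pos_iff_ne_zero, Ne, Finset.sum_eq_zero_iff]
    have he : ∀ k, lam {x | (k, x) ∈ {ω : Γ.Env | Γ.state (Γ.blindStrat τ) ω (s * n0) = k'}} =
        lam {x | Γ.runF τ 0 k (unif x) (s * n0) = k'} := by
      intro k
      congr 1
      ext x
      show Γ.state (Γ.blindStrat τ) (k, x) (s * n0) = k' ↔ Γ.runF τ 0 k (unif x) (s * n0) = k'
      rw [POMDP.state_eq]
    constructor
    · intro h
      push Not at h
      obtain ⟨k, _, hk⟩ := h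
      rw [he, mul_ne_zero_iff] at hk
      obtain ⟨j, hj⟩ := (hKc k).1 (by simpa using hk.1)
      exact ⟨j, (hsup j k').2 ⟨k, hj, hk.2⟩⟩
    · rintro ⟨j, hj⟩ hall
      obtain ⟨k, hk, hr⟩ := (hsup j k').1 hj
      have h := hall k (Finset.mem_univ _)
      rw [he, mul_eq_zero] at h
      rcases h with h | h
      · have := (hKc k).2 ⟨j, hk⟩
        rw [ENNReal.ofReal_eq_zero] at h
        linarith
      · exact hr h
  · rw [POMDP.prob, POMDP.envMeasure_apply _ _ (hmS _ _)]
    have : ∀ k, ENNReal.ofReal (pstar k) * lam {x | (k, x) ∈ {ω : Γ.Env |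
        Γ.state (Γ.blindStrat τ) ω (s * n0) ∈ B i}} =
        if k ∈ Kc i then ENNReal.ofReal (pstar k) else 0 := by
      intro k
      rcases (hps.1 k).eq_or_lt with h0 | h0
      · simp [← h0]
      · split_ifs with hki
        · have h1 : lam {x | (k, x) ∈ {ω : Γ.Env |
              Γ.state (Γ.blindStrat τ) ω (s * n0) ∈ B i}} = lam Set.univ := by
            refine measure_congr ?_
            filter_upwards [hiff k h0] with x hx
            refine propext (iff_of_true ?_ trivial)
            show Γ.state (Γ.blindStrat τ) (k, x) (s * n0) ∈ B i
            rw [POMDP.state_eq]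
            exact hx.2 hki
          rw [h1, measure_univ, mul_one]
        · have h1 : lam {x | (k, x) ∈ {ω : Γ.Env |
              Γ.state (Γ.blindStrat τ) ω (s * n0) ∈ B i}} = lam ∅ := by
            refine measure_congr ?_
            filter_upwards [hiff k h0] with x hx
            refine propext (iff_of_false ?_ id)
            show ¬ Γ.state (Γ.blindStrat τ) (k, x) (s * n0) ∈ B i
            rw [POMDP.state_eq]
            exact fun h => hki (hx.1 h)
          rw [h1, measure_empty, mul_zero]
    rw [Finset.sum_congr rfl fun k _ => this k, Finset.sum_ite_mem, Finset.univ_inter,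
      ← ENNReal.ofReal_sum_of_nonneg fun k _ => hps.1 k,
      ENNReal.toReal_ofReal (Finset.sum_nonneg fun k _ => hps.1 k)]

end PomdpPaper
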